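/- Let S and A be finite nonempty types, T : S × A → PMF S a Markov kernel, and μπ, μE probability mass functions on S × A with μπ absolutely continuous with respect to μE. Suppose the state-transition marginals of the induced joint distributions coincide, i.e., D_KL(ρπ(s,s') ‖ ρE(s,s')) = 0. Then the inverse dynamics disagreement satisfies D_KL(ρπ(a|s,s') ‖ ρE(a|s,s')) = −H(μπ) − Σ_{(s,a)} μπ(s,a)·log μE(s,a), where H(μπ) = −Σ_{(s,a)} μπ(s,a)·log μπ(s,a) is the entropy of the state-action occupancy measure. -/

import Mathlib

open scoped BigOperators

/-- Kullback–Leibler divergence: `D_KL(p ‖ q) = Σ_x p(x)·log(p(x)/q(x))`,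
with terms where `p x = 0` equal to `0`. -/
noncomputable def klDiv {X : Type*} [Fintype X] (p q : X → ℝ) : ℝ :=
  ∑ x, p x * Real.log (p x / q x)

/-- Entropy of a probability mass function: `H(μ) = −Σ_x μ(x)·log μ(x)`. -/
noncomputable def entropy {X : Type*} [Fintype X] (p : X → ℝ) : ℝ :=
  -∑ x, p x * Real.log (p x)

/-- The real-valued mass function of a `PMF`. -/
noncomputable def pmfReal {X : Type*} (μ : PMF X) : X → ℝ := fun x => (μ x).toReal

/-- The joint distribution on `S × A × S` induced by a state-action occupancy
measure `μ` and a Markov kernel `T`: `ρ(s,a,s') = μ(s,a) · T(s,a)(s')`. -/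
noncomputable def joint {S A : Type*} (T : S × A → PMF S) (μ : PMF (S × A)) :
    S × A × S → ℝ :=
  fun x => (μ (x.1, x.2.1)).toReal * ((T (x.1, x.2.1)) x.2.2).toReal

/-- The state-transition marginal `ρ(s,s') = Σ_a ρ(s,a,s')`. -/
noncomputable def transMarg {S A : Type*} [Fintype A]
    (T : S × A → PMF S) (μ : PMF (S × A)) : S × S → ℝ :=
  fun p => ∑ a : A, joint T μ (p.1, a, p.2)

/-- The inverse dynamics conditional `ρ(a|s,s') = ρ(s,a,s') / ρ(s,s')`,
meaningful whenever `ρ(s,s') > 0`. -/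
noncomputable def invCond {S A : Type*} [Fintype A]
    (T : S × A → PMF S) (μ : PMF (S × A)) : S × A × S → ℝ :=
  fun x => joint T μ x / transMarg T μ (x.1, x.2.2)

/-- The inverse dynamics disagreement
`Σ_{(s,a,s')} ρπ(s,a,s')·log(ρπ(a|s,s')/ρE(a|s,s'))`. -/
noncomputable def invDynDisagreement {S A : Type*} [Fintype S] [Fintype A]
    (T : S × A → PMF S) (μπ μE : PMF (S × A)) : ℝ :=
  ∑ x : S × A × S, joint T μπ x * Real.log (invCond T μπ x / invCond T μE x)

theorem joint_nonneg {S A : Type*} (T : S × A → PMF S) (μ : PMF (S × A)) (x : S × A × S) :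
    0 ≤ joint T μ x :=
  mul_nonneg ENNReal.toReal_nonneg ENNReal.toReal_nonneg

theorem joint_le_transMarg {S A : Type*} [Fintype A] (T : S × A → PMF S) (μ : PMF (S × A))
    (s : S) (a : A) (s' : S) : joint T μ (s, a, s') ≤ transMarg T μ (s, s') :=
  Finset.single_le_sum (f := fun a => joint T μ (s, a, s'))
    (fun _ _ => joint_nonneg T μ _) (Finset.mem_univ a)

theorem sum_toReal_eq_one {X : Type*} [Fintype X] (p : PMF X) : ∑ x, (p x).toReal = 1 := by
  rw [← ENNReal.toReal_sum fun x _ => p.apply_ne_top x, ← tsum_fintype (L := .unconditional X),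
    p.tsum_coe, ENNReal.toReal_one]

/-- The integrand of the inverse dynamics disagreement splits into the log-ratio of the
occupancy measures and that of the state-transition marginals. -/
theorem joint_mul_log_invCond_div {S A : Type*} [Fintype A]
    (T : S × A → PMF S) (μπ μE : PMF (S × A)) (hac : ∀ x : S × A, 0 < μπ x → 0 < μE x)
    (s : S) (a : A) (s' : S) :
    joint T μπ (s, a, s') * Real.log (invCond T μπ (s, a, s') / invCond T μE (s, a, s')) =
      (μπ (s, a)).toReal * (Real.log (μπ (s, a)).toReal - Real.log (μE (s, a)).toReal) *
          (T (s, a) s').toReal -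
        joint T μπ (s, a, s') * Real.log (transMarg T μπ (s, s') / transMarg T μE (s, s')) := by
  have hJ (μ : PMF (S × A)) :
      joint T μ (s, a, s') = (μ (s, a)).toReal * (T (s, a) s').toReal := rfl
  by_cases hμ : (μπ (s, a)).toReal = 0
  · simp [hJ, hμ]
  by_cases hT : (T (s, a) s').toReal = 0
  · simp [hJ, hT]
  have hE : 0 < (μE (s, a)).toReal :=
    ENNReal.toReal_pos (hac _ (pos_iff_ne_zero.2 fun h => hμ (by simp [h]))).ne'
      (μE.apply_ne_top _)
  have hTpos : 0 < (T (s, a) s').toReal := ENNReal.toReal_nonneg.lt_of_ne' hT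
  have hμpos : 0 < (μπ (s, a)).toReal := ENNReal.toReal_nonneg.lt_of_ne' hμ
  have hMπ : transMarg T μπ (s, s') ≠ 0 :=
    ((mul_pos hμpos hTpos).trans_le (joint_le_transMarg T μπ s a s')).ne'
  have hME : transMarg T μE (s, s') ≠ 0 :=
    ((mul_pos hE hTpos).trans_le (joint_le_transMarg T μE s a s')).ne'
  simp only [invCond, hJ]
  rw [Real.log_div (by positivity) (by positivity), Real.log_div (by positivity) hMπ,
    Real.log_div (by positivity) hME, Real.log_div hMπ hME, Real.log_mul hμ hT,
    Real.log_mul hE.ne' hT]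
  ring

/-- If the naive LfO objective `D_KL(ρπ(s,s') ‖ ρE(s,s'))` is zero, then the
inverse dynamics disagreement equals
`−H(μπ) − Σ_{(s,a)} μπ(s,a)·log μE(s,a)`. -/
theorem invDynDisagreement_eq_neg_entropy_sub {S A : Type*}
    [Fintype S] [Fintype A] [Nonempty S] [Nonempty A]
    (T : S × A → PMF S) (μπ μE : PMF (S × A))
    (hac : ∀ x : S × A, 0 < μπ x → 0 < μE x)
    (hmatch : klDiv (transMarg T μπ) (transMarg T μE) = 0) :
    invDynDisagreement T μπ μE =
      -entropy (pmfReal μπ) -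
        ∑ x : S × A, (μπ x).toReal * Real.log (μE x).toReal := by
  have hmarg : ∑ s, ∑ a, ∑ s', joint T μπ (s, a, s') *
      Real.log (transMarg T μπ (s, s') / transMarg T μE (s, s')) = 0 := by
    rw [← hmatch, klDiv, Fintype.sum_prod_type]
    refine Finset.sum_congr rfl fun s _ => ?_
    rw [Finset.sum_comm]
    refine Finset.sum_congr rfl fun s' _ => ?_
    rw [← Finset.sum_mul, transMarg]
  simp only [invDynDisagreement, entropy, pmfReal, Fintype.sum_prod_type,
    joint_mul_log_invCond_div T μπ μE hac, Finset.sum_sub_distrib, hmarg, ← Finset.mul_sum,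
    sum_toReal_eq_one, mul_one, mul_sub, neg_neg, sub_zero]
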